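/- Let (Z_1, Z_2) be a centered bivariate Gaussian pair with Var(Z_1) = Var(Z_2) = 1 and Cov(Z_1, Z_2) = ρ, and let f, g : ℝ → [0,1] be non-decreasing and left-continuous with Lebesgue–Stieltjes measures μ_f and μ_g. Then Cov( f(Z_1), g(Z_2) ) = ∬ Cov( 1_{Z_1 > t}, 1_{Z_2 > s} ) dμ_f(t) dμ_g(s). -/

import Mathlib

open MeasureTheory ProbabilityTheory

lemma aux_stieltjes (f : ℝ → ℝ) (hf : Monotone f) (hf01 : ∀ x : ℝ, f x ∈ Set.Icc (0 : ℝ) 1)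
    (μ : Measure ℝ)
    (hμ : ∀ a b : ℝ, a ≤ b → μ (Set.Ico a b) = ENNReal.ofReal (f b - f a)) :
    IsFiniteMeasure μ ∧ ∃ c : ℝ, ∀ x, f x = c + μ.real (Set.Iio x) := by
  have hfin : IsFiniteMeasure μ := by
    constructor
    have hmono : Monotone (fun n : ℕ => Set.Ico (-(n : ℝ)) n) := by
      intro m n hmn
      have : (m : ℝ) ≤ n := by exact_mod_cast hmn
      exact Set.Ico_subset_Ico (by linarith) this
    have hU : (⋃ n : ℕ, Set.Ico (-(n : ℝ)) n) = Set.univ := by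
      ext x
      simp only [Set.mem_iUnion, Set.mem_univ, iff_true, Set.mem_Ico]
      obtain ⟨n, hn⟩ := exists_nat_gt |x|
      have := abs_lt.1 hn
      exact ⟨n, this.1.le, this.2⟩
    have : μ Set.univ ≤ 1 := by
      rw [← hU, hmono.measure_iUnion]
      refine iSup_le fun n => ?_
      have hn : (0 : ℝ) ≤ n := Nat.cast_nonneg n
      rw [hμ _ _ (by linarith), ← ENNReal.ofReal_one]
      apply ENNReal.ofReal_le_ofReal
      linarith [(hf01 n).2, (hf01 (-(n : ℝ))).1]
    exact this.trans_lt ENNReal.one_lt_top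
  refine ⟨hfin, ⨅ x, f x, fun x => ?_⟩
  have hbdd : BddBelow (Set.range f) := ⟨0, by rintro _ ⟨y, rfl⟩; exact (hf01 y).1⟩
  have hmono : Monotone (fun n : ℕ => Set.Ico (x - (n : ℝ)) x) := by
    intro m n hmn
    have : (m : ℝ) ≤ n := by exact_mod_cast hmn
    exact Set.Ico_subset_Ico (by linarith) le_rfl
  have hU : (⋃ n : ℕ, Set.Ico (x - (n : ℝ)) x) = Set.Iio x := by
    ext y
    simp only [Set.mem_iUnion, Set.mem_Iio, Set.mem_Ico]
    constructor
    · rintro ⟨n, h⟩; exact h.2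
    · intro h
      obtain ⟨n, hn⟩ := exists_nat_gt (x - y)
      exact ⟨n, by linarith, h⟩
  have h1 : Filter.Tendsto (fun n : ℕ => μ (Set.Ico (x - (n : ℝ)) x)) Filter.atTop
      (nhds (μ (Set.Iio x))) := by
    rw [← hU]; exact tendsto_measure_iUnion_atTop hmono
  have h2 : Filter.Tendsto (fun n : ℕ => f x - f (x - n)) Filter.atTop
      (nhds (μ.real (Set.Iio x))) := by
    refine ((ENNReal.tendsto_toReal (measure_ne_top μ _)).comp h1).congr fun n => ?_
    have hn : (0 : ℝ) ≤ n := Nat.cast_nonneg n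
    simp only [Function.comp]
    rw [hμ _ _ (by linarith), ENNReal.toReal_ofReal]
    linarith [hf (show x - n ≤ x by linarith)]
  have h3 : Filter.Tendsto (fun n : ℕ => f (x - n)) Filter.atTop (nhds (⨅ x, f x)) := by
    refine (tendsto_atBot_ciInf hf hbdd).comp ?_
    exact Filter.tendsto_atBot_add_const_left _ x
      (Filter.tendsto_neg_atTop_atBot.comp tendsto_natCast_atTop_atTop)
  have h4 := tendsto_nhds_unique h2 (h3.const_sub (f x))
  linarith

lemma aux_fubini {α Ω : Type*} [MeasurableSpace α] [MeasurableSpace Ω] (μ : Measure α)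
    (P : Measure Ω) [IsFiniteMeasure μ] [IsFiniteMeasure P] (S : Set (α × Ω))
    (hS : MeasurableSet S) :
    ∫ p, μ.real {a | (a, p) ∈ S} ∂P = ∫ a, P.real {p | (a, p) ∈ S} ∂μ := by
  have hint : Integrable (fun z : α × Ω => S.indicator (fun _ => (1 : ℝ)) z) (μ.prod P) :=
    (integrable_const (1 : ℝ)).indicator hS
  have h := integral_integral_swap (f := fun a p => S.indicator (fun _ => (1 : ℝ)) (a, p)) hint
  rw [show (∫ a, P.real {p | (a, p) ∈ S} ∂μ)
      = ∫ a, ∫ p, S.indicator (fun _ => (1 : ℝ)) (a, p) ∂P ∂μ from ?_, h]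
  · refine integral_congr_ae (Filter.Eventually.of_forall fun p => ?_)
    have : (fun a => S.indicator (fun _ => (1 : ℝ)) (a, p))
        = {a | (a, p) ∈ S}.indicator (fun _ => (1 : ℝ)) := rfl
    simp only [this]
    have hm : MeasurableSet {a | (a, p) ∈ S} := measurable_prodMk_right hS
    rw [integral_indicator_const _ hm]
    simp
  · refine integral_congr_ae (Filter.Eventually.of_forall fun a => ?_)
    have : (fun p => S.indicator (fun _ => (1 : ℝ)) (a, p))
        = {p | (a, p) ∈ S}.indicator (fun _ => (1 : ℝ)) := rfl
    simp only [this]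
    have hm : MeasurableSet {p | (a, p) ∈ S} := measurable_prodMk_left hS
    rw [integral_indicator_const _ hm]
    simp

lemma aux_meas {α Ω : Type*} [MeasurableSpace α] [MeasurableSpace Ω]
    (P : Measure Ω) [IsFiniteMeasure P] (S : Set (α × Ω))
    (hS : MeasurableSet S) : Measurable (fun a => P.real {p | (a, p) ∈ S}) :=
  (measurable_measure_prodMk_left hS).ennreal_toReal

lemma aux_int {α Ω : Type*} [MeasurableSpace α] [MeasurableSpace Ω] (μ : Measure α)
    (P : Measure Ω) [IsFiniteMeasure μ] [IsFiniteMeasure P] (S : Set (α × Ω))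
    (hS : MeasurableSet S) : Integrable (fun a => P.real {p | (a, p) ∈ S}) μ := by
  refine Integrable.of_bound (aux_meas P S hS).aestronglyMeasurable (P.real Set.univ)
    (Filter.Eventually.of_forall fun a => ?_)
  rw [Real.norm_of_nonneg measureReal_nonneg]
  exact measureReal_mono (Set.subset_univ _)

lemma aux_main {Ω : Type*} [MeasurableSpace Ω] (P : Measure Ω) [IsProbabilityMeasure P]
    (X Y : Ω → ℝ) (hX : Measurable X) (hY : Measurable Y) (f g : ℝ → ℝ)
    (μ ν : Measure ℝ) [IsFiniteMeasure μ] [IsFiniteMeasure ν] (c d : ℝ)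
    (hf : ∀ x, f x = c + μ.real (Set.Iio x)) (hg : ∀ x, g x = d + ν.real (Set.Iio x)) :
    (∫ p, f (X p) * g (Y p) ∂P) - (∫ p, f (X p) ∂P) * (∫ p, g (Y p) ∂P) =
      ∫ t, (∫ s, (P.real {p | t < X p ∧ s < Y p} -
        P.real {p | t < X p} * P.real {p | s < Y p}) ∂ν) ∂μ := by
  have hSX : MeasurableSet {z : ℝ × Ω | z.1 < X z.2} :=
    measurableSet_lt measurable_fst (hX.comp measurable_snd)
  have hSY : MeasurableSet {z : ℝ × Ω | z.1 < Y z.2} :=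
    measurableSet_lt measurable_fst (hY.comp measurable_snd)
  have hSXY : MeasurableSet {z : (ℝ × ℝ) × Ω | z.1.1 < X z.2 ∧ z.1.2 < Y z.2} :=
    (measurableSet_lt (measurable_fst.comp measurable_fst) (hX.comp measurable_snd)).inter
      (measurableSet_lt (measurable_snd.comp measurable_fst) (hY.comp measurable_snd))
  have eX := aux_fubini μ P _ hSX
  have eY := aux_fubini ν P _ hSY
  have eXY := aux_fubini (μ.prod ν) P _ hSXY
  have iX := aux_int μ P _ hSX
  have iY := aux_int ν P _ hSY
  have iXY := aux_int (μ.prod ν) P _ hSXY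
  have hprod : ∀ p, (μ.prod ν).real {a : ℝ × ℝ | a.1 < X p ∧ a.2 < Y p}
      = μ.real (Set.Iio (X p)) * ν.real (Set.Iio (Y p)) := fun p =>
    measureReal_prod_prod (Set.Iio (X p)) (Set.Iio (Y p))
  simp only [Set.mem_ofPred_eq] at eX eY eXY iX iY iXY
  simp only [hprod] at eXY
  have hmF : Measurable (fun p => μ.real (Set.Iio (X p))) :=
    (measurable_measure_prodMk_right hSX).ennreal_toReal
  have hmG : Measurable (fun p => ν.real (Set.Iio (Y p))) :=
    (measurable_measure_prodMk_right hSY).ennreal_toReal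
  have bF : ∀ p, ‖μ.real (Set.Iio (X p))‖ ≤ μ.real Set.univ := fun p => by
    rw [Real.norm_of_nonneg measureReal_nonneg]
    exact measureReal_mono (Set.subset_univ _)
  have bG : ∀ p, ‖ν.real (Set.Iio (Y p))‖ ≤ ν.real Set.univ := fun p => by
    rw [Real.norm_of_nonneg measureReal_nonneg]
    exact measureReal_mono (Set.subset_univ _)
  have iF : Integrable (fun p => μ.real (Set.Iio (X p))) P :=
    Integrable.of_bound hmF.aestronglyMeasurable _ (Filter.Eventually.of_forall bF)
  have iG : Integrable (fun p => ν.real (Set.Iio (Y p))) P :=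
    Integrable.of_bound hmG.aestronglyMeasurable _ (Filter.Eventually.of_forall bG)
  have iFG : Integrable (fun p => μ.real (Set.Iio (X p)) * ν.real (Set.Iio (Y p))) P :=
    iF.mul_bdd hmG.aestronglyMeasurable (Filter.Eventually.of_forall bG)
  have hR : ∫ t, (∫ s, (P.real {p | t < X p ∧ s < Y p} -
        P.real {p | t < X p} * P.real {p | s < Y p}) ∂ν) ∂μ
      = (∫ p, μ.real (Set.Iio (X p)) * ν.real (Set.Iio (Y p)) ∂P)
        - (∫ p, μ.real (Set.Iio (X p)) ∂P) * (∫ p, ν.real (Set.Iio (Y p)) ∂P) := by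
    have iM := iX.mul_prod iY
    have h := integral_prod _ (iXY.sub iM)
    simp only [Pi.sub_apply] at h
    rw [← h, integral_sub iXY iM, ← eXY, integral_prod_mul (μ := μ) (ν := ν)
      (fun t => P.real {p | t < X p}) (fun s => P.real {p | s < Y p}), ← eX, ← eY]
    rfl
  rw [hR]
  have e1 : ∫ p, f (X p) ∂P = c + ∫ p, μ.real (Set.Iio (X p)) ∂P := by
    simp only [hf]
    rw [integral_add (integrable_const _) iF]; simp
  have e2 : ∫ p, g (Y p) ∂P = d + ∫ p, ν.real (Set.Iio (Y p)) ∂P := by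
    simp only [hg]
    rw [integral_add (integrable_const _) iG]; simp
  have e3 : ∫ p, f (X p) * g (Y p) ∂P = c * d + c * (∫ p, ν.real (Set.Iio (Y p)) ∂P)
      + d * (∫ p, μ.real (Set.Iio (X p)) ∂P)
      + ∫ p, μ.real (Set.Iio (X p)) * ν.real (Set.Iio (Y p)) ∂P := by
    have : ∀ p, f (X p) * g (Y p) = c * d + c * ν.real (Set.Iio (Y p))
        + d * μ.real (Set.Iio (X p)) + μ.real (Set.Iio (X p)) * ν.real (Set.Iio (Y p)) := by
      intro p; rw [hf, hg]; ring
    simp only [this]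
    have j0 : Integrable (fun _ : Ω => c * d) P := integrable_const _
    have j1 : Integrable (fun p => c * d + c * ν.real (Set.Iio (Y p))) P :=
      j0.add (iG.const_mul c)
    have j2 : Integrable (fun p => c * d + c * ν.real (Set.Iio (Y p))
        + d * μ.real (Set.Iio (X p))) P := j1.add (iF.const_mul d)
    rw [integral_add j2 iFG, integral_add j1 (iF.const_mul d), integral_add j0 (iG.const_mul c),
      integral_const_mul c (fun p => ν.real (Set.Iio (Y p))),
      integral_const_mul d (fun p => μ.real (Set.Iio (X p)))]
    simp
  rw [e1, e2, e3]; ring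

/-- A centered bivariate Gaussian pair `(Z₁, Z₂)` with unit variances and correlation `ρ`,
realized as `Z₁(x,y) = x`, `Z₂(x,y) = ρ x + √(1-ρ²) y` on the product of two standard
Gaussians. The covariance of `f(Z₁)` and `g(Z₂)` equals the double integral of the
covariances of the threshold indicators against the Lebesgue–Stieltjes measures `μ_f, μ_g`. -/
theorem stmt15 (ρ : ℝ) (hρ1 : -1 ≤ ρ) (hρ2 : ρ ≤ 1)
    (f g : ℝ → ℝ) (hf : Monotone f) (hg : Monotone g)
    (hfl : ∀ x : ℝ, ContinuousWithinAt f (Set.Iio x) x)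
    (hgl : ∀ x : ℝ, ContinuousWithinAt g (Set.Iio x) x)
    (hf01 : ∀ x : ℝ, f x ∈ Set.Icc (0 : ℝ) 1)
    (hg01 : ∀ x : ℝ, g x ∈ Set.Icc (0 : ℝ) 1)
    (μf μg : Measure ℝ)
    (hμf : ∀ a b : ℝ, a ≤ b → μf (Set.Ico a b) = ENNReal.ofReal (f b - f a))
    (hμg : ∀ a b : ℝ, a ≤ b → μg (Set.Ico a b) = ENNReal.ofReal (g b - g a))
    (P : Measure (ℝ × ℝ)) (hP : P = (gaussianReal 0 1).prod (gaussianReal 0 1))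
    (Z₁ Z₂ : ℝ × ℝ → ℝ) (hZ₁ : Z₁ = fun p => p.1)
    (hZ₂ : Z₂ = fun p => ρ * p.1 + Real.sqrt (1 - ρ ^ 2) * p.2) :
    (∫ p, f (Z₁ p) * g (Z₂ p) ∂P) -
        (∫ p, f (Z₁ p) ∂P) * (∫ p, g (Z₂ p) ∂P) =
      ∫ t, (∫ s, ((P {p | t < Z₁ p ∧ s < Z₂ p}).toReal -
        (P {p | t < Z₁ p}).toReal * (P {p | s < Z₂ p}).toReal) ∂μg) ∂μf := by
  obtain ⟨h1, c, hc⟩ := aux_stieltjes f hf hf01 μf hμf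
  obtain ⟨h2, d, hd⟩ := aux_stieltjes g hg hg01 μg hμg
  subst hP
  have hm1 : Measurable Z₁ := by rw [hZ₁]; exact measurable_fst
  have hm2 : Measurable Z₂ := by rw [hZ₂]; fun_prop
  exact aux_main _ Z₁ Z₂ hm1 hm2 f g μf μg c d hc hd
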